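/- There do not exist continuous maps F, G : S² → ℝ³ such that for every p = (y₁, y₂, y₃) ∈ S² ⊂ ℝ³, the cross product F(p) × G(p) equals (y₃, −y₂, y₁). -/

import Mathlib

theorem exp_const_aux {g : ℝ → ℂ} (hg : Continuous g) (c : ℂ)
    (h : ∀ t, Complex.exp (g t) = c) (a b : ℝ) : g a = g b :=
  Complex.isCoveringMap_exp.const_of_comp hg
    (fun a a' => Subtype.ext (by simp [h])) a b

/-- There are no continuous maps `F, G : S² → ℝ³` such that for every
`p = (y₁, y₂, y₃) ∈ S²` the cross product `F(p) × G(p)` equals `(y₃, −y₂, y₁)`. -/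
theorem no_continuous_cross_product_framing :
    ¬ ∃ F G : {y : Fin 3 → ℝ // y 0 ^ 2 + y 1 ^ 2 + y 2 ^ 2 = 1} → (Fin 3 → ℝ),
      Continuous F ∧ Continuous G ∧
      ∀ p, crossProduct (F p) (G p) = ![p.1 2, -(p.1 1), p.1 0] := by
  rintro ⟨F, G, hF, -, h⟩
  let P : ℝ × ℝ → {y : Fin 3 → ℝ // y 0 ^ 2 + y 1 ^ 2 + y 2 ^ 2 = 1} := fun x =>
    ⟨![Real.cos x.1, -(Real.sin x.1 * Real.sin x.2), Real.sin x.1 * Real.cos x.2], by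
      simp only [Matrix.cons_val]
      linear_combination Real.sin_sq_add_cos_sq x.1
        + Real.sin x.1 ^ 2 * Real.sin_sq_add_cos_sq x.2⟩
  have hP : Continuous P := by
    refine Continuous.subtype_mk (continuous_pi fun i => ?_) _
    fin_cases i <;> simp <;> fun_prop
  let f : ℝ × ℝ → Fin 3 → ℝ := fun x => F (P x)
  have hf : Continuous f := hF.comp hP
  have hf0 : Continuous fun x => f x 0 := (continuous_apply 0).comp hf
  have hf1 : Continuous fun x => f x 1 := (continuous_apply 1).comp hf
  have hf2 : Continuous fun x => f x 2 := (continuous_apply 2).comp hf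
  let u : ℝ × ℝ → ℝ := fun x => f x 0 * (Real.cos x.1 * Real.cos x.2)
    + f x 1 * (Real.cos x.1 * Real.sin x.2) - f x 2 * Real.sin x.1
  let w : ℝ × ℝ → ℝ := fun x => - f x 0 * Real.sin x.2 + f x 1 * Real.cos x.2
  have hu : Continuous u := by fun_prop
  have hw : Continuous w := by fun_prop
  let v : C(ℝ × ℝ, ℂ) := ⟨fun x => (u x : ℂ) + (w x : ℂ) * Complex.I, by fun_prop⟩
  have hv : ∀ x, v x ≠ 0 := by
    intro x hx
    have h1 : u x = 0 := by simpa [v] using congrArg Complex.re hx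
    have h2 : w x = 0 := by simpa [v] using congrArg Complex.im hx
    have hc := h (P x)
    have e0 := congrFun hc 0
    have e1 := congrFun hc 1
    have e2 := congrFun hc 2
    simp only [crossProduct, LinearMap.mk₂_apply, Matrix.cons_val, P] at e0 e1 e2
    change f x 1 * _ - f x 2 * _ = _ at e0
    change f x 2 * _ - f x 0 * _ = _ at e1
    change f x 0 * _ - f x 1 * _ = _ at e2
    have h3 : f x 0 * (Real.sin x.1 * Real.cos x.2) + f x 1 * (Real.sin x.1 * Real.sin x.2)
        + f x 2 * Real.cos x.1 = 0 := by
      linear_combination -f x 0 * e0 - f x 1 * e1 - f x 2 * e2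
    simp only [u, w] at h1 h2
    have s1 := Real.sin_sq_add_cos_sq x.1
    have s2 := Real.sin_sq_add_cos_sq x.2
    have k2 : f x 2 = 0 := by
      linear_combination Real.cos x.1 * h3 - Real.sin x.1 * h1 - f x 2 * s1
    have k : f x 0 * Real.cos x.2 + f x 1 * Real.sin x.2 = 0 := by
      linear_combination Real.sin x.1 * h3 + Real.cos x.1 * h1
        - (f x 0 * Real.cos x.2 + f x 1 * Real.sin x.2) * s1
    have k0 : f x 0 = 0 := by
      linear_combination Real.cos x.2 * k - Real.sin x.2 * h2 - f x 0 * s2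
    have k1 : f x 1 = 0 := by
      linear_combination Real.sin x.2 * k + Real.cos x.2 * h2 - f x 1 * s2
    rw [k1, k2] at e0
    rw [k0, k2] at e1
    rw [k0, k1] at e2
    have e1' : Real.sin x.1 * Real.sin x.2 = 0 := by linear_combination -e1
    have e0' : Real.sin x.1 * Real.cos x.2 = 0 := by linear_combination -e0
    have e2' : Real.cos x.1 = 0 := by linear_combination -e2
    have : (1:ℝ) = 0 := by
      linear_combination -s1 - Real.sin x.1 ^ 2 * s2 + Real.cos x.1 * e2'
        + Real.sin x.1 * Real.sin x.2 * e1' + Real.sin x.1 * Real.cos x.2 * e0'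
    exact one_ne_zero this
  obtain ⟨L, ⟨-, hL⟩, -⟩ := Complex.isCoveringMapOn_exp.existsUnique_continuousMap_lifts v
    (a₀ := (0, 0)) (e₀ := Complex.log (v (0, 0))) (Complex.exp_log (hv _)) (fun a => hv a)
  have hL' : ∀ x, Complex.exp (L x) = v x := fun x => congrFun hL x
  have hLc : Continuous L := L.continuous
  have per : ∀ t, v (t, 2 * Real.pi) = v (t, 0) := by
    intro t
    have : P (t, 2 * Real.pi) = P (t, 0) := by simp [P]
    simp [v, u, w, f, this]
  have A := exp_const_aux (g := fun t => L (t, 2 * Real.pi) - L (t, 0)) (by fun_prop) 1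
    (fun t => by rw [Complex.exp_sub, hL', hL', per, div_self (hv _)]) 0 Real.pi
  have B := exp_const_aux (g := fun t => L (0, t) + t * Complex.I) (by fun_prop) (v (0, 0))
    (fun t => by
      have : P (0, t) = P (0, 0) := by simp [P]
      rw [Complex.exp_add, hL', Complex.exp_mul_I]
      simp only [v, u, w, f, this, ContinuousMap.coe_mk]
      simp only [Real.cos_zero, Real.sin_zero]
      push_cast
      linear_combination (F (P (0, 0)) 0 + F (P (0, 0)) 1 * Complex.I) *
        Complex.sin_sq_add_cos_sq (t : ℂ) + (- F (P (0, 0)) 0 * Complex.sin t ^ 2 +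
          F (P (0, 0)) 1 * Complex.cos t * Complex.sin t) * Complex.I_sq) 0 (2 * Real.pi)
  have C := exp_const_aux (g := fun t => L (Real.pi, t) - t * Complex.I) (by fun_prop)
    (v (Real.pi, 0))
    (fun t => by
      have : P (Real.pi, t) = P (Real.pi, 0) := by simp [P]
      rw [Complex.exp_sub, hL', div_eq_iff (Complex.exp_ne_zero _), Complex.exp_mul_I]
      simp only [v, u, w, f, this, ContinuousMap.coe_mk]
      simp only [Real.cos_zero, Real.sin_zero, Real.cos_pi, Real.sin_pi]
      push_cast
      linear_combination (- F (P (Real.pi, 0)) 1 * Complex.sin t) * Complex.I_sq)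
      0 (2 * Real.pi)
  simp only [Complex.ofReal_zero, zero_mul, add_zero, sub_zero] at A B C
  push_cast at B C
  have D : (4 * Real.pi : ℂ) * Complex.I = 0 := by linear_combination C - A - B
  simp [Real.pi_ne_zero] at D
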